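/- Let W = (P,[n]) be an admissible Wilson loop diagram. For every propagator p = (i,j) ∈ P, the four sets J_p^W(v) = {m ∈ [n] : I_m^W(p) = v} for v ∈ {i, i+1, j, j+1} are each nonempty cyclic intervals of [n], they partition [n], and they occur around the cycle in the cyclic order J_p^W(i), J_p^W(i+1), J_p^W(j), J_p^W(j+1). -/

import Mathlib

open scoped Classical

namespace WLD

/-- A propagator of a Wilson loop diagram on the cyclically ordered vertex set
`ZMod n` (vertex `n` is identified with `0`): an unordered pair of edges, the
edge joining vertex `i` to vertex `i+1` being labelled `i`. -/
abbrev Prp (n : ℕ) := Sym2 (ZMod n)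

variable (n : ℕ)

/-- The position of `x` in the linear order `i <_i i+1 <_i ⋯ <_i i-1`. -/
def ord (i x : ZMod n) : ℕ := (x - i).val

/-- The other end of a propagator `p` having an end on the edge `e`. -/
noncomputable def otherEnd (p : Prp n) (e : ZMod n) : ZMod n :=
  if h : e ∈ p then Sym2.Mem.other h else e

/-- The vertex support `V(p) = {i, i+1, j, j+1}` of the propagator `p = (i,j)`. -/
def supp (p : Prp n) : Finset (ZMod n) :=
  Sym2.lift ⟨fun i j => {i, i + 1, j, j + 1}, fun i j => by
    ext x
    simp only [Finset.mem_insert, Finset.mem_singleton]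
    tauto⟩ p

/-- The vertex support `V(Q)` of a set of propagators. -/
def suppSet (Q : Finset (Prp n)) : Finset (ZMod n) := Q.biUnion (supp n)

/-- `Prop(U)`: the propagators of `P` supported on (a vertex of) `U`. -/
noncomputable def propsOn (P : Finset (Prp n)) (U : Finset (ZMod n)) : Finset (Prp n) :=
  P.filter fun p => (supp n p ∩ U).Nonempty

/-- Two propagators `p = (i,j)` and `q = (k,l)` cross if `i < k < j < l` cyclically. -/
def Crossing (p q : Prp n) : Prop :=
  ∃ i j k l : ZMod n, p = s(i, j) ∧ q = s(k, l) ∧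
    0 < ord n i k ∧ ord n i k < ord n i j ∧ ord n i j < ord n i l

/-- Weak admissibility of a Wilson loop diagram. -/
structure IsWeaklyAdmissible (P : Finset (Prp n)) : Prop where
  dense : ∀ Q ⊆ P, Q.Nonempty → Q.card + 3 ≤ (suppSet n Q).card
  noncross : ∀ p ∈ P, ∀ q ∈ P, ¬ Crossing n p q

/-- Admissibility of a Wilson loop diagram. -/
structure IsAdmissible (P : Finset (Prp n)) : Prop where
  card_add_four_le : P.card + 4 ≤ n
  dense : ∀ Q ⊆ P, Q.Nonempty → Q.card + 3 ≤ (suppSet n Q).card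
  noncross : ∀ p ∈ P, ∀ q ∈ P, ¬ Crossing n p q

/-- The length of a propagator `p = (i,j)`:
`min(|[i+1, j]|, |[j+1, i]|)`, the number of vertices on its smaller side. -/
def plength (p : Prp n) : ℕ :=
  Sym2.lift ⟨fun i j => min ((j - i - 1).val + 1) ((i - j - 1).val + 1),
    fun _ _ => min_comm _ _⟩ p

/-- `InsideDir n i p q` : the propagator `q = (k,l)` lies (weakly) inside the
propagator `p = (i,j)` directed from its end `i`, i.e. `i ≤_i k <_i l ≤_i j`. -/
def InsideDir (i : ZMod n) (p q : Prp n) : Prop :=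
  ∃ j k l : ZMod n, p = s(i, j) ∧ q = s(k, l) ∧
    ord n i k < ord n i l ∧ ord n i l ≤ ord n i j

/-- Sorting key measuring how far clockwise of the vertex `a` the relevant end of
a propagator supported on `a` is attached: ends on the edge `a-1` are clockwise of
ends on the edge `a`, and on a fixed edge an end is the more clockwise the larger
the propagator is (nestedness of noncrossing propagators sharing an edge). -/
noncomputable def cwKey (a : ZMod n) (p : Prp n) : ℕ :=
  if a - 1 ∈ p then n + ord n (a - 1) (otherEnd n p (a - 1))
  else ord n a (otherEnd n p a)

/-- The clockwise-most propagator of `S` supported on the vertex `a`, if any. -/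
noncomputable def pickCW (S : Finset (Prp n)) (a : ZMod n) : Option (Prp n) :=
  if h : (S.filter fun p => a ∈ supp n p).Nonempty then
    some (Classical.choose
      ((S.filter fun p => a ∈ supp n p).exists_max_image (cwKey n a) h))
  else none

/-- The Grassmann necklace algorithm started at the vertex `i`: after `t` steps,
`(gnRun n P i t).1` is the set of propagators not yet deleted, and
`(gnRun n P i t).2` records the vertex assigned to each deleted propagator.
Step `t+1` processes the vertex `i + t`: if some not-yet-deleted propagator is
supported on it, the clockwise-most such propagator is deleted and assigned
that vertex. -/
noncomputable def gnRun (P : Finset (Prp n)) (i : ZMod n) :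
    ℕ → Finset (Prp n) × (Prp n → Option (ZMod n))
  | 0 => (P, fun _ => none)
  | t + 1 =>
    match pickCW n (gnRun P i t).1 (i + (t : ZMod n)) with
    | none => gnRun P i t
    | some p => ((gnRun P i t).1.erase p,
        Function.update (gnRun P i t).2 p (some (i + (t : ZMod n))))

/-- `I_i^W(p)`: the vertex contributed by the propagator `p` to the Grassmann
necklace term `I_i^W` (as an `Option`; the algorithm makes one full circuit of
the vertex set, i.e. runs for `n` steps). -/
noncomputable def gnAssign (P : Finset (Prp n)) (i : ZMod n) (p : Prp n) :
    Option (ZMod n) :=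
  (gnRun n P i n).2 p

/-- The Grassmann necklace term `I_i^W` produced by the algorithm. -/
noncomputable def gnSet [NeZero n] (P : Finset (Prp n)) (i : ZMod n) :
    Finset (ZMod n) :=
  Finset.univ.filter fun v => ∃ p, gnAssign n P i p = some v

/-- The cyclic interval `{a, a+1, …, a + (len-1)}` in `ZMod n`. -/
def cInterval [NeZero n] (a : ZMod n) (len : ℕ) : Finset (ZMod n) :=
  Finset.univ.filter fun x => ord n a x < len

/-- A Grassmann necklace of type `(k, n)`: a cyclic sequence of `k`-element
subsets of the vertex set such that `I_{i+1} = (I_i \ {i}) ∪ {j}` for some `j`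
whenever `i ∈ I_i`, and `I_{i+1} = I_i` otherwise. -/
def IsGrassmannNecklace [NeZero n] (k : ℕ) (I : ZMod n → Finset (ZMod n)) : Prop :=
  (∀ i, (I i).card = k) ∧
  ∀ i : ZMod n,
    (i ∈ I i → ∃ j : ZMod n, I (i + 1) = insert j ((I i).erase i)) ∧
    (i ∉ I i → I (i + 1) = I i)

/-- Independence in the matroid `M(W)`: no subset `U` of `J` supports fewer
propagators than the vertices it contains. -/
def Indep (P : Finset (Prp n)) (J : Finset (ZMod n)) : Prop :=
  ∀ U ⊆ J, U.card ≤ (propsOn n P U).card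

/-- `A` is lexicographically smaller than `B` with respect to the order `<_i`:
the `<_i`-least element of the symmetric difference lies in `A`. -/
def LexLt (i : ZMod n) (A B : Finset (ZMod n)) : Prop :=
  ∃ v, v ∈ A ∧ v ∉ B ∧ ∀ w, ord n i w < ord n i v → (w ∈ A ↔ w ∈ B)

/-- A `+` is placed in the box `(a, b)` of the Le diagram with row labels `I₁`
by the necklace term `Ii`: writing `I₁ \ Ii = {a₁ > ⋯ > a_r}` and
`Ii \ I₁ = {b₁ < ⋯ < b_r}` in the `<₁` order, the plusses are in the boxes
`(a_t, b_t)`. -/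
def LePlusAt (I₁ Ii : Finset (ZMod n)) (a b : ZMod n) : Prop :=
  a ∈ I₁ \ Ii ∧ b ∈ Ii \ I₁ ∧
    ((I₁ \ Ii).filter fun x => ord n 1 a < ord n 1 x).card =
      ((Ii \ I₁).filter fun y => ord n 1 y < ord n 1 b).card

/-- The box `(a, b)` of the Le diagram of the diagram `P` contains a `+`. -/
def LePlus [NeZero n] (P : Finset (Prp n)) (a b : ZMod n) : Prop :=
  ∃ i : ZMod n, LePlusAt n (gnSet n P 1) (gnSet n P i) a b

/-- The number of `+` entries in the Le diagram of the diagram `P`. -/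
noncomputable def plusCount [NeZero n] (P : Finset (Prp n)) : ℕ :=
  (Finset.univ.filter fun ab : ZMod n × ZMod n => LePlus n P ab.1 ab.2).card

/-- The length of the row labelled `a` of the Young diagram with row labels `I₁`
(the boxes of row `a` are indexed by the column labels `b ∉ I₁` with `a <₁ b`). -/
noncomputable def rowLen [NeZero n] (I₁ : Finset (ZMod n)) (a : ZMod n) : ℕ :=
  (Finset.univ.filter fun b => b ∉ I₁ ∧ ord n 1 a < ord n 1 b).card

/-- The entry of the matrix `C(W)` in row `p` and column `q`: the indeterminate
`x_{p,q}` if `q ∈ V(p)`, and `0` otherwise. -/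
noncomputable def CW (p : Prp n) (q : ZMod n) : MvPolynomial (Prp n × ZMod n) ℝ :=
  if q ∈ supp n p then MvPolynomial.X (p, q) else 0

/-- The column paired with the row `p` in the minors determined by `I_i^W`. -/
noncomputable def colOf (P : Finset (Prp n)) (i : ZMod n) (p : Prp n) : ZMod n :=
  (gnAssign n P i p).getD i

/-- `Δ_{I_i}`: the determinant of the `k × k` minor of `C(W)` on the columns
indexed by `I_i^W`, rows and columns paired via the necklace assignment. -/
noncomputable def Delta (P : Finset (Prp n)) (i : ZMod n) :
    MvPolynomial (Prp n × ZMod n) ℝ :=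
  Matrix.det (Matrix.of fun p q : ↥P => CW n (p : Prp n) (colOf n P i (q : Prp n)))

/-- `S_i`: the propagators whose contribution changes from `I_{i-1}` to `I_i`. -/
noncomputable def Schanged (P : Finset (Prp n)) (i : ZMod n) : Finset (Prp n) :=
  P.filter fun p => gnAssign n P (i - 1) p ≠ gnAssign n P i p

/-- `r_i`: the determinant of the minor of `C(W)` with rows indexed by `S_i` and
columns indexed by `I_i(S_i)` (equal to `1` when `S_i = ∅`). -/
noncomputable def rfac (P : Finset (Prp n)) (i : ZMod n) :
    MvPolynomial (Prp n × ZMod n) ℝ :=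
  Matrix.det
    (Matrix.of fun p q : ↥(Schanged n P i) => CW n (p : Prp n) (colOf n P i (q : Prp n)))

/-- `R = ∏ᵢ rᵢ`, the polynomial produced by the algorithm. -/
noncomputable def Rpoly [NeZero n] (P : Finset (Prp n)) :
    MvPolynomial (Prp n × ZMod n) ℝ :=
  ∏ i : ZMod n, rfac n P i

/-- Position of the end of the propagator `p` along the edge `e`: larger values
attach closer to the vertex `e`, i.e. earlier in the counterclockwise ordering
of the ends of propagators along the edge `e`. -/
noncomputable def edgeKey (e : ZMod n) (p : Prp n) : ℕ := ord n e (otherEnd n p e)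

/-- The propagators of `P` with an end on the edge `e`. -/
noncomputable def onEdge (P : Finset (Prp n)) (e : ZMod n) : Finset (Prp n) :=
  P.filter fun p => e ∈ p

/-- `p` is the first propagator (`p₁`) on the edge `e` in the counterclockwise
ordering of the propagators with an end on the edge `e`. -/
def IsCcwFirst (P : Finset (Prp n)) (e : ZMod n) (p : Prp n) : Prop :=
  p ∈ onEdge n P e ∧ ∀ q ∈ onEdge n P e, edgeKey n e q ≤ edgeKey n e p

/-- `p` is the last propagator (`p_r`) on the edge `e` in the counterclockwise
ordering of the propagators with an end on the edge `e`. -/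
def IsCcwLast (P : Finset (Prp n)) (e : ZMod n) (p : Prp n) : Prop :=
  p ∈ onEdge n P e ∧ ∀ q ∈ onEdge n P e, edgeKey n e p ≤ edgeKey n e q

/-- `p` and `q` are consecutive, in this order (`p = p_j`, `q = p_{j+1}`), in the
counterclockwise ordering of the propagators with an end on the edge `e`. -/
def ConsecOnEdge (P : Finset (Prp n)) (e : ZMod n) (p q : Prp n) : Prop :=
  p ∈ onEdge n P e ∧ q ∈ onEdge n P e ∧ edgeKey n e q < edgeKey n e p ∧
    ∀ r ∈ onEdge n P e, ¬ (edgeKey n e q < edgeKey n e r ∧ edgeKey n e r < edgeKey n e p)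

/-- The factor `R_e` of the denominator `R(W)` associated to the edge `e`:
`R_e = x_{p₁,e+1} • ∏_{j=1}^{r-1} (x_{p_j,e} x_{p_{j+1},e+1} - x_{p_{j+1},e} x_{p_j,e+1}) • x_{p_r,e}`
for the counterclockwise ordering `p₁, …, p_r` of the propagators on the edge `e`
(`R_e = 1` if there are none). -/
noncomputable def Redge (P : Finset (Prp n)) (e : ZMod n) :
    MvPolynomial (Prp n × ZMod n) ℝ :=
  (∏ p ∈ (onEdge n P e).filter (IsCcwFirst n P e), MvPolynomial.X (p, e + 1)) *
    (∏ pq ∈ (P ×ˢ P).filter (fun pq => ConsecOnEdge n P e pq.1 pq.2),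
      (MvPolynomial.X (pq.1, e) * MvPolynomial.X (pq.2, e + 1) -
        MvPolynomial.X (pq.2, e) * MvPolynomial.X (pq.1, e + 1))) *
    (∏ p ∈ (onEdge n P e).filter (IsCcwLast n P e), MvPolynomial.X (p, e))

/-- The denominator `R(W) = ∏ₑ R_e` of the integrand `Ω(W)`. -/
noncomputable def RW [NeZero n] (P : Finset (Prp n)) :
    MvPolynomial (Prp n × ZMod n) ℝ :=
  ∏ e : ZMod n, Redge n P e

/-- The relabelling map associated to the removal of the vertex `i` from the
vertex set `ZMod n`: the vertex of `ZMod (n-1)` in position `t` (in the `<₁`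
order) is sent to the vertex of `ZMod n` in position `t` if `t` precedes the
position of `i`, and to the vertex in position `t+1` otherwise. -/
noncomputable def liftVert (i : ZMod n) (x : ZMod (n - 1)) : ZMod n :=
  1 + ((if ord (n - 1) 1 x < ord n 1 i then ord (n - 1) 1 x
        else ord (n - 1) 1 x + 1 : ℕ) : ZMod n)

end WLD
namespace WLD

section Positions

variable {n : ℕ}

lemma ord_add_natCast (i : ZMod n) {x : ℕ} (hx : x < n) : ord n i (i + (x : ZMod n)) = x := by
  simp [ord, ZMod.val_natCast, Nat.mod_eq_of_lt hx]

lemma ord_add_add_of_le (i : ZMod n) {x y : ℕ} (hxy : x ≤ y) (hy : y < n + x) :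
    ord n (i + (x : ZMod n)) (i + (y : ZMod n)) = y - x := by
  obtain ⟨z, rfl⟩ := Nat.exists_eq_add_of_le hxy
  have : i + ((x + z : ℕ) : ZMod n) = (i + (x : ZMod n)) + (z : ZMod n) := by
    push_cast; ring
  rw [this, ord_add_natCast _ (by omega)]
  omega

lemma ord_add_add_of_lt (i : ZMod n) {x y : ℕ} (hxy : y < x) (hx : x ≤ n + y) :
    ord n (i + (x : ZMod n)) (i + (y : ZMod n)) = n + y - x := by
  have : i + (y : ZMod n) = i + ((n + y : ℕ) : ZMod n) := by simp
  rw [this, ord_add_add_of_le _ hx (by omega)]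

lemma add_natCast_inj (i : ZMod n) {x y : ℕ} (hx : x < n) (hy : y < n)
    (h : i + (x : ZMod n) = i + (y : ZMod n)) : x = y := by
  rw [← ord_add_natCast i hx, h, ord_add_natCast i hy]

variable [NeZero n]

lemma ord_lt (i x : ZMod n) : ord n i x < n := ZMod.val_lt _

lemma add_ord (i x : ZMod n) : i + (ord n i x : ZMod n) = x := by
  simp [ord]

lemma ord_inj {i x y : ZMod n} (h : ord n i x = ord n i y) : x = y := by
  rw [← add_ord i x, ← add_ord i y, h]

lemma ord_add_ord {i j : ZMod n} (h : i ≠ j) : ord n i j + ord n j i = n := by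
  have h1 := ord_lt i j
  have h0 : ord n i j ≠ 0 := fun h0 => h (by simpa [h0] using add_ord i j)
  have h2 := ord_add_add_of_lt i (x := ord n i j) (y := 0) (by omega) (by omega)
  rw [add_ord] at h2
  simp only [Nat.cast_zero, add_zero] at h2
  omega

lemma mem_cInterval_add {a x : ZMod n} {t l : ℕ} (h : t + l ≤ n) :
    x ∈ cInterval n (a + (t : ZMod n)) l ↔ t ≤ ord n a x ∧ ord n a x < t + l := by
  have hlt := ord_lt a x
  simp only [cInterval, Finset.mem_filter, Finset.mem_univ, true_and]
  nth_rewrite 1 [← add_ord a x]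
  rcases le_or_gt t (ord n a x) with h1 | h1
  · rw [ord_add_add_of_le a h1 (by omega)]; omega
  · rw [ord_add_add_of_lt a h1 (by omega)]; omega

end Positions

section Picking

variable {n : ℕ}

lemma mem_supp_mk {i j x : ZMod n} :
    x ∈ supp n s(i, j) ↔ x = i ∨ x = i + 1 ∨ x = j ∨ x = j + 1 := by
  simp [supp]

lemma mem_or_mem_of_mem_supp {a : ZMod n} {p : Prp n} (h : a ∈ supp n p) :
    a - 1 ∈ p ∨ a ∈ p := by
  induction p using Sym2.ind with
  | h i j =>
    rw [mem_supp_mk] at h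
    simp only [Sym2.mem_iff]
    rcases h with rfl | rfl | rfl | rfl <;> simp

lemma otherEnd_mk (e k : ZMod n) : otherEnd n s(e, k) e = k := by
  have h : e ∈ s(e, k) := Sym2.mem_mk_left e k
  rw [otherEnd, dif_pos h]
  exact Sym2.congr_right.1 (Sym2.other_spec h)

lemma cwKey_mk_of_add_one (e k : ZMod n) : cwKey n (e + 1) s(e, k) = n + ord n e k := by
  simp [cwKey, otherEnd_mk]

lemma cwKey_mk_of_notMem {a k : ZMod n} (h : a - 1 ∉ s(a, k)) :
    cwKey n a s(a, k) = ord n a k := by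
  rw [cwKey, if_neg h, otherEnd_mk]

lemma pickCW_ne_none {S : Finset (Prp n)} {a : ZMod n} {p : Prp n} (hp : p ∈ S)
    (ha : a ∈ supp n p) : pickCW n S a ≠ none := by
  rw [pickCW, dif_pos ⟨p, by simp [hp, ha]⟩]
  simp

variable [NeZero n]

lemma cwKey_lt_of_notMem {a : ZMod n} {p : Prp n} (h : a - 1 ∉ p) : cwKey n a p < n := by
  rw [cwKey, if_neg h]
  exact ord_lt _ _

lemma cwKey_inj {a : ZMod n} {p q : Prp n} (hp : a ∈ supp n p) (hq : a ∈ supp n q)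
    (h : cwKey n a p = cwKey n a q) : p = q := by
  by_cases hp' : a - 1 ∈ p <;> by_cases hq' : a - 1 ∈ q
  · obtain ⟨k, rfl⟩ := hp'
    obtain ⟨l, rfl⟩ := hq'
    obtain ⟨e, rfl⟩ : ∃ e, a = e + 1 := ⟨a - 1, by ring⟩
    simp only [add_sub_cancel_right, cwKey_mk_of_add_one] at h ⊢
    rw [ord_inj (Nat.add_left_cancel h)]
  · have := cwKey_lt_of_notMem hq'
    rw [← h, cwKey, if_pos hp'] at this
    omega
  · have := cwKey_lt_of_notMem hp'
    rw [h, cwKey, if_pos hq'] at this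
    omega
  · obtain ⟨k, rfl⟩ := (mem_or_mem_of_mem_supp hp).resolve_left hp'
    obtain ⟨l, rfl⟩ := (mem_or_mem_of_mem_supp hq).resolve_left hq'
    rw [cwKey_mk_of_notMem hp', cwKey_mk_of_notMem hq'] at h
    rw [ord_inj h]

lemma pickCW_eq_some_iff {S : Finset (Prp n)} {a : ZMod n} {p : Prp n} :
    pickCW n S a = some p ↔
      p ∈ S ∧ a ∈ supp n p ∧ ∀ q ∈ S, a ∈ supp n q → cwKey n a q ≤ cwKey n a p := by
  by_cases h : (S.filter fun p => a ∈ supp n p).Nonempty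
  · have hs := Classical.choose_spec
      ((S.filter fun p => a ∈ supp n p).exists_max_image (cwKey n a) h)
    rw [pickCW, dif_pos h, Option.some_inj]
    set r := Classical.choose
      ((S.filter fun p => a ∈ supp n p).exists_max_image (cwKey n a) h)
    simp only [Finset.mem_filter, and_imp] at hs
    constructor
    · rintro rfl
      exact ⟨hs.1.1, hs.1.2, hs.2⟩
    · rintro ⟨h1, h2, h3⟩
      exact cwKey_inj hs.1.2 h2 (le_antisymm (h3 _ hs.1.1 hs.1.2) (hs.2 _ h1 h2))
  · rw [pickCW, dif_neg h]
    simp only [reduceCtorEq, false_iff]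
    rintro ⟨h1, h2, -⟩
    exact h ⟨p, by simp [h1, h2]⟩

end Picking

section Runs

variable {n : ℕ} {P : Finset (Prp n)} {m : ZMod n}

lemma gnRun_succ_of_eq_none {t : ℕ} (h : pickCW n (gnRun n P m t).1 (m + (t : ZMod n)) = none) :
    gnRun n P m (t + 1) = gnRun n P m t := by
  rw [gnRun, h]

lemma gnRun_succ_of_eq_some {t : ℕ} {p : Prp n}
    (h : pickCW n (gnRun n P m t).1 (m + (t : ZMod n)) = some p) :
    gnRun n P m (t + 1) = ((gnRun n P m t).1.erase p,
        Function.update (gnRun n P m t).2 p (some (m + (t : ZMod n)))) := by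
  rw [gnRun, h]

lemma mem_gnRun_succ {t : ℕ} {p : Prp n} :
    p ∈ (gnRun n P m (t + 1)).1 ↔
      p ∈ (gnRun n P m t).1 ∧ pickCW n (gnRun n P m t).1 (m + (t : ZMod n)) ≠ some p := by
  cases h : pickCW n (gnRun n P m t).1 (m + (t : ZMod n)) with
  | none => simp [gnRun_succ_of_eq_none h]
  | some q =>
    rw [gnRun_succ_of_eq_some h]
    simp only [Finset.mem_erase, ne_eq, Option.some_inj]
    tauto

lemma gnRun_antitone : Antitone fun t => (gnRun n P m t).1 :=
  antitone_nat_of_succ_le fun _ _ h => (mem_gnRun_succ.1 h).1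

lemma gnRun_subset (t : ℕ) : (gnRun n P m t).1 ⊆ P :=
  gnRun_antitone (P := P) (m := m) (Nat.zero_le t)

lemma notMem_gnRun_of_pick {s t : ℕ} (hst : s < t) {p : Prp n}
    (h : pickCW n (gnRun n P m s).1 (m + (s : ZMod n)) = some p) : p ∉ (gnRun n P m t).1 :=
  fun hp => (mem_gnRun_succ.1 (gnRun_antitone (P := P) (m := m) (Nat.succ_le_of_lt hst) hp)).2 h

lemma exists_pick_of_notMem {t : ℕ} {p : Prp n} (hp : p ∈ P) (h : p ∉ (gnRun n P m t).1) :
    ∃ s < t, pickCW n (gnRun n P m s).1 (m + (s : ZMod n)) = some p := by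
  induction t with
  | zero => exact absurd hp h
  | succ t ih =>
    by_cases h' : p ∈ (gnRun n P m t).1
    · refine ⟨t, by omega, ?_⟩
      by_contra hc
      exact h (mem_gnRun_succ.2 ⟨h', hc⟩)
    · obtain ⟨s, hs, h1⟩ := ih h'
      exact ⟨s, by omega, h1⟩

variable [NeZero n]

lemma gnRun_snd_eq_some_iff {t : ℕ} {p : Prp n} {v : ZMod n} :
    (gnRun n P m t).2 p = some v ↔
      ∃ s < t, pickCW n (gnRun n P m s).1 (m + (s : ZMod n)) = some p ∧ m + (s : ZMod n) = v := by
  induction t with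
  | zero => simp [gnRun]
  | succ t ih =>
    cases h : pickCW n (gnRun n P m t).1 (m + (t : ZMod n)) with
    | none =>
      rw [gnRun_succ_of_eq_none h, ih]
      constructor
      · rintro ⟨s, hs, h1⟩
        exact ⟨s, by omega, h1⟩
      · rintro ⟨s, hs, h1, h2⟩
        rcases Nat.lt_succ_iff_lt_or_eq.1 hs with hs | rfl
        · exact ⟨s, hs, h1, h2⟩
        · simp [h] at h1
    | some q =>
      rw [gnRun_succ_of_eq_some h]
      by_cases hpq : p = q
      · subst hpq
        simp only [Function.update_self, Option.some_inj]
        constructor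
        · rintro rfl
          exact ⟨t, by omega, h, rfl⟩
        · rintro ⟨s, hs, h1, rfl⟩
          rcases Nat.lt_succ_iff_lt_or_eq.1 hs with hs | rfl
          · exact absurd (pickCW_eq_some_iff.1 h).1 (notMem_gnRun_of_pick hs h1)
          · rfl
      · simp only [Function.update_of_ne hpq, ih]
        constructor
        · rintro ⟨s, hs, h1⟩
          exact ⟨s, by omega, h1⟩
        · rintro ⟨s, hs, h1, h2⟩
          rcases Nat.lt_succ_iff_lt_or_eq.1 hs with hs | rfl
          · exact ⟨s, hs, h1, h2⟩
          · rw [h, Option.some_inj] at h1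
            exact absurd h1.symm hpq

lemma mem_gnRun_of_notMem_supp {t : ℕ} {p : Prp n} (hp : p ∈ P)
    (h : ∀ s < t, m + (s : ZMod n) ∉ supp n p) : p ∈ (gnRun n P m t).1 := by
  by_contra hc
  obtain ⟨s, hs, h1⟩ := exists_pick_of_notMem hp hc
  exact h s hs (pickCW_eq_some_iff.1 h1).2.1

/-- Starting the algorithm one vertex later can only postpone the deletion of a propagator. -/
lemma gnRun_succ_subset_gnRun_add_one (t : ℕ) :
    (gnRun n P m (t + 1)).1 ⊆ (gnRun n P (m + 1) t).1 := by
  induction t with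
  | zero => exact gnRun_subset 1
  | succ t ih =>
    intro q hq
    rw [mem_gnRun_succ] at hq ⊢
    have hv : m + 1 + (t : ZMod n) = m + ((t + 1 : ℕ) : ZMod n) := by push_cast; ring
    refine ⟨ih hq.1, fun hc => hq.2 ?_⟩
    rw [hv, pickCW_eq_some_iff] at hc
    exact pickCW_eq_some_iff.2 ⟨hq.1, hc.2.1, fun r hr => hc.2.2 r (ih hr)⟩

end Runs

section Noncrossing

variable {n : ℕ} {P : Finset (Prp n)} (hadm : IsAdmissible n P)
include hadm

lemma IsAdmissible.false_of_interleaved {i : ZMod n} {a b c d : ℕ}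
    (h₁ : s(i + (a : ZMod n), i + (b : ZMod n)) ∈ P)
    (h₂ : s(i + (c : ZMod n), i + (d : ZMod n)) ∈ P)
    (hac : a < c) (hcb : c < b) (hbd : b < d) (hd : d < n) : False := by
  refine hadm.noncross _ h₁ _ h₂ ⟨_, _, _, _, rfl, rfl, ?_⟩
  rw [ord_add_add_of_le i (by omega) (by omega), ord_add_add_of_le i (by omega) (by omega),
    ord_add_add_of_le i (by omega) (by omega)]
  omega

lemma IsAdmissible.card_supp {i j : ZMod n} (h : s(i, j) ∈ P) :
    4 ≤ ({i, i + 1, j, j + 1} : Finset (ZMod n)).card := by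
  have := hadm.dense {s(i, j)} (by simpa using h) (by simp)
  simpa [suppSet, supp] using this

variable [NeZero n]

lemma IsAdmissible.two_le_ord {i j : ZMod n} (h : s(i, j) ∈ P) :
    2 ≤ ord n i j ∧ ord n i j + 2 ≤ n := by
  have h4 := hadm.card_supp h
  have hlt := ord_lt i j
  have h3 (a b c : ZMod n) : ({a, b, c} : Finset (ZMod n)).card < 4 :=
    Nat.lt_succ_of_le Finset.card_le_three
  by_contra hc
  have hj := add_ord i j
  refine absurd h4 (not_le.2 ?_)
  obtain h0 | h0 | h0 : ord n i j = 0 ∨ ord n i j = 1 ∨ ord n i j + 1 = n := by omega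
  · have : j = i := by simpa [h0] using hj.symm
    subst this
    simpa [Finset.insert_comm] using h3 j (j + 1) (j + 1)
  · have : j = i + 1 := by simpa [h0] using hj.symm
    subst this
    simpa using h3 i (i + 1) (i + 1 + 1)
  · have : j + 1 = i := by
      have h5 : ((ord n i j + 1 : ℕ) : ZMod n) = 0 := by rw [h0]; simp
      rw [← hj, add_assoc]
      push_cast at h5
      rw [h5, add_zero]
    have hset : ({i, i + 1, j, j + 1} : Finset (ZMod n)) = {i, i + 1, j} := by
      ext
      simp [this]
      tauto
    rw [hset]
    exact h3 _ _ _

lemma IsAdmissible.add_two_le {i : ZMod n} {a b : ℕ}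
    (h : s(i + (a : ZMod n), i + (b : ZMod n)) ∈ P) (hab : a ≤ b) (hb : b < n) : a + 2 ≤ b := by
  have := (hadm.two_le_ord h).1
  rw [ord_add_add_of_le i hab (by omega)] at this
  omega

/-- A propagator is the clockwise-most one on its vertex `i + b` once every propagator strictly
nested on its `[i + a, i + b]` side has been deleted. -/
lemma IsAdmissible.pickCW_eq_of_nested_notMem {i : ZMod n} {a b : ℕ} {S : Finset (Prp n)}
    (hS : S ⊆ P) (hp : s(i + (a : ZMod n), i + (b : ZMod n)) ∈ S) (hab : a ≤ b) (hb : b < n)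
    (hin : ∀ x y : ℕ, a ≤ x → x < y → y ≤ b → a < x ∨ y < b →
      s(i + (x : ZMod n), i + (y : ZMod n)) ∉ S) :
    pickCW n S (i + (b : ZMod n)) = some s(i + (a : ZMod n), i + (b : ZMod n)) := by
  have hab2 := hadm.add_two_le (hS hp) hab hb
  have hb1 : i + (b : ZMod n) - 1 = i + ((b - 1 : ℕ) : ZMod n) := by
    rw [Nat.cast_sub (by omega)]; push_cast; ring
  refine pickCW_eq_some_iff.2 ⟨hp, mem_supp_mk.2 (by simp), fun q hq hbq => ?_⟩
  have hkey : cwKey n (i + (b : ZMod n)) s(i + (a : ZMod n), i + (b : ZMod n)) = n + a - b := by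
    rw [Sym2.eq_swap, cwKey_mk_of_notMem, ord_add_add_of_lt i (by omega) (by omega)]
    rw [hb1, Sym2.mem_iff]
    rintro (h | h) <;> have := add_natCast_inj i (by omega) (by omega) h <;> omega
  rw [hkey]
  by_cases hq1 : i + (b : ZMod n) - 1 ∈ q
  · exfalso
    rw [hb1] at hq1
    obtain ⟨k, rfl⟩ := hq1
    obtain ⟨z, hz, rfl⟩ : ∃ z < n, k = i + (z : ZMod n) := ⟨_, ord_lt i k, (add_ord i k).symm⟩
    rcases lt_trichotomy z (b - 1) with h1 | h1 | h1
    · rw [Sym2.eq_swap] at hq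
      by_cases h2 : z < a
      · exact hadm.false_of_interleaved (hS hq) (hS hp) h2 (by omega) (by omega) hb
      · exact hin z (b - 1) (by omega) h1 (by omega) (by omega) hq
    · have := hadm.add_two_le (hS hq) (by omega) hz
      omega
    · by_cases h2 : b < z
      · exact hadm.false_of_interleaved (hS hp) (hS hq) (by omega) (by omega) h2 hz
      · exact hin (b - 1) z (by omega) h1 (by omega) (by omega) hq
  · obtain ⟨k, rfl⟩ := (mem_or_mem_of_mem_supp hbq).resolve_left hq1
    obtain ⟨z, hz, rfl⟩ : ∃ z < n, k = i + (z : ZMod n) := ⟨_, ord_lt i k, (add_ord i k).symm⟩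
    rw [cwKey_mk_of_notMem hq1]
    rcases le_or_gt b z with h1 | h1
    · rw [ord_add_add_of_le i h1 (by omega)]
      omega
    · rw [ord_add_add_of_lt i h1 (by omega)]
      by_contra hc
      rw [Sym2.eq_swap] at hq
      exact hin z b (by omega) h1 le_rfl (by omega) hq

/-- Let `R v` be the propagators remaining when a run of the algorithm reaches the vertex `i + v`.
When it reaches the second end of a propagator, having visited every vertex strictly between the
supporting edges of that propagator, it has deleted all propagators nested on this side. -/
lemma IsAdmissible.nested_notMem {i : ZMod n} {R : ℕ → Finset (Prp n)} (hR : ∀ v, R v ⊆ P)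
    (hstep : ∀ v, 2 ≤ v → ∀ p, p ∈ R (v + 1) ↔
      p ∈ R v ∧ pickCW n (R v) (i + (v : ZMod n)) ≠ some p)
    (d : ℕ) : ∀ x y : ℕ, y = x + d → y < n → s(i + (x : ZMod n), i + (y : ZMod n)) ∈ P →
      ∀ x' y' : ℕ, x ≤ x' → x' < y' → y' ≤ y → x < x' ∨ y' < y →
        s(i + (x' : ZMod n), i + (y' : ZMod n)) ∉ R y := by
  have hanti {u v : ℕ} (hu : 2 ≤ u) (huv : u ≤ v) : R v ⊆ R u := by
    induction v, huv using Nat.le_induction with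
    | base => rfl
    | succ v huv ih => exact fun p hp => ih ((hstep v (by omega) p).1 hp).1
  induction d using Nat.strong_induction_on with
  | _ d ih =>
    intro x y hxy hy hp x' y' hx' hxy' hy' hne hq
    have hgap := hadm.add_two_le (hR _ hq) hxy'.le (by omega)
    have hshort {a b : ℕ} (hab : a < b) (hbd : b < a + d) (hb : b < n) :
        s(i + (a : ZMod n), i + (b : ZMod n)) ∉ R (b + 1) := by
      intro hr
      have hrP := hR _ hr
      have hgap := hadm.add_two_le hrP hab.le hb
      rw [hstep b (by omega)] at hr
      exact hr.2 (hadm.pickCW_eq_of_nested_notMem (hR _) hr.1 hab.le hb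
        (ih (b - a) (by omega) a b (by omega) hb hrP))
    rcases hy'.lt_or_eq with hlt | rfl
    · exact hshort hxy' (by omega) (by omega) (hanti (by omega) hlt hq)
    · have hv : i + ((x' + 1 : ℕ) : ZMod n) = i + (x' : ZMod n) + 1 := by push_cast; ring
      have hq' := (hstep (x' + 1) (by omega) _).1 (hanti (by omega) hgap hq)
      obtain ⟨r, hr⟩ := Option.ne_none_iff_exists'.1
        (pickCW_ne_none hq'.1 (mem_supp_mk.2 (Or.inr (Or.inl hv))))
      obtain ⟨hrR, hrv, hmax⟩ := pickCW_eq_some_iff.1 hr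
      have hkey := hmax _ hq'.1 (mem_supp_mk.2 (Or.inr (Or.inl hv)))
      rw [hv, cwKey_mk_of_add_one, ord_add_add_of_le i hxy'.le (by omega)] at hkey
      have hxr : i + (x' : ZMod n) ∈ r := by
        by_contra hc
        have := cwKey_lt_of_notMem (a := i + (x' : ZMod n) + 1) (p := r)
          (by rwa [add_sub_cancel_right])
        omega
      obtain ⟨k, rfl⟩ := hxr
      obtain ⟨z, hz, rfl⟩ : ∃ z < n, k = i + (z : ZMod n) := ⟨_, ord_lt i k, (add_ord i k).symm⟩
      rw [cwKey_mk_of_add_one] at hkey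
      rcases lt_trichotomy z x' with h1 | rfl | h1
      · rw [Sym2.eq_swap] at hrR
        by_cases h2 : z < x
        · exact hadm.false_of_interleaved (hR _ hrR) hp h2 (by omega) hxy' hy
        · exact hshort h1 (by omega) (by omega) hrR
      · have := hadm.add_two_le (hR _ hrR) le_rfl hz
        omega
      · rw [ord_add_add_of_le i h1.le (by omega)] at hkey
        by_cases h2 : y' < z
        · exact hadm.false_of_interleaved hp (hR _ hrR) (by omega) hxy' h2 hz
        · obtain rfl : z = y' := by omega
          exact hq'.2 hr

end Noncrossing

section Assignment

variable {n : ℕ} [NeZero n] {P : Finset (Prp n)} (hadm : IsAdmissible n P) {m i j : ZMod n}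
include hadm

lemma IsAdmissible.nested_notMem_gnRun (hp : s(i, j) ∈ P) {t : ℕ}
    (ht : m + (t : ZMod n) = i + 2) {x y : ℕ} (hxy : x < y) (hy : y ≤ ord n i j)
    (hne : 0 < x ∨ y < ord n i j) :
    s(i + (x : ZMod n), i + (y : ZMod n)) ∉ (gnRun n P m (t + (ord n i j - 2))).1 := by
  refine hadm.nested_notMem (R := fun v => (gnRun n P m (t + (v - 2))).1)
    (fun v => gnRun_subset _) (fun v hv p => ?_) (ord n i j) 0 (ord n i j) (by omega) (ord_lt i j)
    (by simpa [add_ord] using hp) x y (by omega) hxy hy hne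
  obtain ⟨u, rfl⟩ := Nat.exists_eq_add_of_le' hv
  have hu : m + ((t + u : ℕ) : ZMod n) = i + ((u + 2 : ℕ) : ZMod n) := by
    push_cast; rw [← add_assoc, ht]; ring
  simp only [show u + 2 + 1 - 2 = u + 1 by omega, show u + 2 - 2 = u by omega, ← add_assoc t u 1]
  rw [mem_gnRun_succ, hu]

lemma IsAdmissible.add_eq_of_add_eq (hp : s(i, j) ∈ P) {t : ℕ} (ht : m + (t : ZMod n) = i + 2) :
    m + ((t + (ord n i j - 2) : ℕ) : ZMod n) = j := by
  obtain ⟨u, hu⟩ := Nat.exists_eq_add_of_le' (hadm.two_le_ord hp).1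
  have h := add_ord i j
  rw [hu] at h
  rw [hu, Nat.add_sub_cancel, ← h]
  push_cast
  rw [← add_assoc, ht]
  ring

lemma IsAdmissible.pickCW_gnRun_of_mem (hp : s(i, j) ∈ P) {t : ℕ}
    (ht : m + (t : ZMod n) = i + 2) (hmem : s(i, j) ∈ (gnRun n P m (t + (ord n i j - 2))).1) :
    pickCW n (gnRun n P m (t + (ord n i j - 2))).1 j = some s(i, j) := by
  have h := hadm.pickCW_eq_of_nested_notMem (i := i) (a := 0) (b := ord n i j) (gnRun_subset _)
    (by simpa [add_ord] using hmem) (Nat.zero_le _) (ord_lt i j)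
    (fun x y _ hxy hy hne => hadm.nested_notMem_gnRun hp ht hxy hy hne)
  simpa [add_ord] using h

lemma IsAdmissible.mem_gnRun_add_two (hp : s(i, j) ∈ P) {t : ℕ} (ht : t + 2 ≤ ord n i j) :
    s(i, j) ∈ (gnRun n P (i + 2) t).1 := by
  have hd := hadm.two_le_ord hp
  have hj := add_ord i j
  refine mem_gnRun_of_notMem_supp hp fun s hs hmem => ?_
  have hv : i + 2 + (s : ZMod n) = i + ((s + 2 : ℕ) : ZMod n) := by push_cast; ring
  rw [mem_supp_mk, hv] at hmem
  have key {y : ℕ} (hy : y < n) (hne : s + 2 ≠ y) (h : i + ((s + 2 : ℕ) : ZMod n) = i + (y : ℕ)) :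
      False := hne (add_natCast_inj i (by omega) hy h)
  rcases hmem with h | h | h | h
  · exact key (y := 0) (by omega) (by omega) (by simpa using h)
  · exact key (y := 1) (by omega) (by omega) (by simpa using h)
  · exact key (y := ord n i j) (by omega) (by omega) (by rw [hj, h])
  · exact key (y := ord n i j + 1) (by omega) (by omega)
      (by rw [h]; push_cast; rw [← add_assoc, hj])

lemma IsAdmissible.pickCW_gnRun_add_two (hp : s(i, j) ∈ P) :
    pickCW n (gnRun n P (i + 2) (ord n i j - 2)).1 j = some s(i, j) := by
  have hd := hadm.two_le_ord hp
  have h := hadm.pickCW_gnRun_of_mem (m := i + 2) hp (t := 0) (by simp)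
  rw [zero_add] at h
  exact h (hadm.mem_gnRun_add_two hp (by omega))

lemma IsAdmissible.gnAssign_add_two (hp : s(i, j) ∈ P) :
    gnAssign n P (i + 2) s(i, j) = some j := by
  have hlt := ord_lt i j
  have hv := hadm.add_eq_of_add_eq (m := i + 2) hp (t := 0) (by simp)
  rw [zero_add] at hv
  refine gnRun_snd_eq_some_iff.2 ⟨ord n i j - 2, by omega, ?_, hv⟩
  rw [hv]
  exact hadm.pickCW_gnRun_add_two hp

/-- Every propagator contributes a vertex to every Grassmann necklace term. -/
lemma IsAdmissible.exists_pick (hp : s(i, j) ∈ P) :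
    ∃ t < n, pickCW n (gnRun n P m t).1 (m + (t : ZMod n)) = some s(i, j) := by
  refine exists_pick_of_notMem hp fun hmem => ?_
  have hfalse {a b : ZMod n} {t : ℕ} (hab : s(i, j) = s(a, b)) (ht : m + (t : ZMod n) = a + 2)
      (hlt : t + (ord n a b - 2) < n) : False := by
    rw [hab] at hp hmem
    refine notMem_gnRun_of_pick hlt ?_ hmem
    rw [hadm.add_eq_of_add_eq hp ht]
    exact hadm.pickCW_gnRun_of_mem hp ht (gnRun_antitone hlt.le hmem)
  have hd := hadm.two_le_ord hp
  have hij : i ≠ j := by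
    rintro rfl
    simp [ord] at hd
  have hsum := ord_add_ord hij
  have ht := add_ord m (i + 2)
  have htn := ord_lt m (i + 2)
  rcases lt_or_ge (ord n m (i + 2) + (ord n i j - 2)) n with h | h
  · exact hfalse rfl ht h
  · refine hfalse (t := ord n m (i + 2) + ord n i j - n) Sym2.eq_swap ?_ (by omega)
    rw [Nat.cast_sub (by omega)]
    push_cast
    rw [ZMod.natCast_self, sub_zero, ← add_assoc, ht, add_right_comm, add_ord]

lemma IsAdmissible.exists_gnAssign_add_one (hp : s(i, j) ∈ P) :
    ∃ m, gnAssign n P m s(i, j) = some (i + 1) := by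
  have hd := hadm.two_le_ord hp
  have hj := add_ord i j
  by_cases hY : ∃ k, s(i, k) ∈ P ∧ ord n i j < ord n i k
  · obtain ⟨k, hk, hmin⟩ := (Finset.univ.filter fun k =>
      s(i, k) ∈ P ∧ ord n i j < ord n i k).exists_min_image (ord n i) (by simpa [Finset.Nonempty])
    simp only [Finset.mem_filter, Finset.mem_univ, true_and, and_imp] at hk hmin
    obtain ⟨hr, hjk⟩ := hk
    have he := hadm.two_le_ord hr
    have hik : i ≠ k := by
      rintro rfl
      simp [ord] at he
    have hsum := ord_add_ord hik
    have hr' := hr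
    rw [Sym2.eq_swap] at hr'
    have hpick := hadm.pickCW_gnRun_add_two hr'
    have hv := hadm.add_eq_of_add_eq (m := k + 2) hr' (t := 0) (by simp)
    rw [zero_add] at hv
    have hpr : s(i, j) ≠ s(i, k) := by
      rw [Ne, Sym2.congr_right]
      rintro rfl
      omega
    have hmem : s(i, j) ∈ (gnRun n P (k + 2) (ord n k i - 2)).1 := by
      refine mem_gnRun_of_notMem_supp hp fun s hs hmem => ?_
      have hv : k + 2 + (s : ZMod n) = i + ((ord n i k + 2 + s : ℕ) : ZMod n) := by
        push_cast; rw [← add_assoc, ← add_assoc, add_ord]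
      rw [mem_supp_mk, hv] at hmem
      have key {y : ℕ} (hy : y < n) (hne : ord n i k + 2 + s ≠ y)
          (h : i + ((ord n i k + 2 + s : ℕ) : ZMod n) = i + (y : ℕ)) : False :=
        hne (add_natCast_inj i (by omega) hy h)
      rcases hmem with h | h | h | h
      · exact key (y := 0) (by omega) (by omega) (by simpa using h)
      · exact key (y := 1) (by omega) (by omega) (by simpa using h)
      · exact key (y := ord n i j) (by omega) (by omega) (by rw [hj, h])
      · exact key (y := ord n i j + 1) (by omega) (by omega)
          (by rw [h]; push_cast; rw [← add_assoc, hj])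
    replace hpick : pickCW n (gnRun n P (k + 2) (ord n k i - 2)).1
        (k + 2 + ((ord n k i - 2 : ℕ) : ZMod n)) = some s(i, k) := by
      rw [hv, hpick, Sym2.eq_swap]
    have hmem' : s(i, j) ∈ (gnRun n P (k + 2) (ord n k i - 2 + 1)).1 := by
      rw [mem_gnRun_succ, hpick, Ne, Option.some_inj]
      exact ⟨hmem, Ne.symm hpr⟩
    have hv1 : k + 2 + ((ord n k i - 2 + 1 : ℕ) : ZMod n) = i + 1 := by
      rw [Nat.cast_add, ← add_assoc, hv, Nat.cast_one]
    refine ⟨k + 2, gnRun_snd_eq_some_iff.2 ⟨ord n k i - 2 + 1, by omega, ?_, hv1⟩⟩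
    rw [hv1]
    refine pickCW_eq_some_iff.2 ⟨hmem', mem_supp_mk.2 (by simp), fun q hq hqv => ?_⟩
    rw [cwKey_mk_of_add_one]
    by_cases hiq : i ∈ q
    · obtain ⟨l, rfl⟩ := hiq
      rw [cwKey_mk_of_add_one]
      by_contra hc
      have hlP := gnRun_subset _ hq
      have hkl := hmin l hlP (by omega)
      have hll := ord_lt i l
      rw [mem_gnRun_succ] at hq
      rcases hkl.lt_or_eq with hlt | heq
      · have hx : ord n k l = ord n i l - ord n i k := by
          conv_lhs => rw [← add_ord i k, ← add_ord i l]
          exact ord_add_add_of_le i hlt.le (by omega)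
        have := hadm.nested_notMem_gnRun (m := k + 2) (t := 0) (x := ord n k l) hr' (by simp)
          (by omega) le_rfl (by omega)
        rw [add_ord, add_ord, zero_add, Sym2.eq_swap] at this
        exact this hq.1
      · obtain rfl := ord_inj heq
        exact hq.2 hpick
    · have := cwKey_lt_of_notMem (a := i + 1) (p := q) (by rwa [add_sub_cancel_right])
      omega
  · push Not at hY
    refine ⟨i + 1, gnRun_snd_eq_some_iff.2 ⟨0, by omega, ?_, by simp⟩⟩
    rw [Nat.cast_zero, add_zero]
    refine pickCW_eq_some_iff.2 ⟨hp, mem_supp_mk.2 (by simp), fun q hq hqv => ?_⟩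
    rw [cwKey_mk_of_add_one]
    by_cases hiq : i ∈ q
    · obtain ⟨l, rfl⟩ := hiq
      rw [cwKey_mk_of_add_one]
      have := hY l hq
      omega
    · have := cwKey_lt_of_notMem (a := i + 1) (p := q) (by rwa [add_sub_cancel_right])
      omega

end Assignment

lemma exists_threshold {n : ℕ} {G : ℕ → ℕ} (hG : ∀ s t, s ≤ t → t < n → G s ≤ G t) (c : ℕ) :
    ∃ u ≤ n, ∀ s < n, s < u ↔ G s < c := by
  have hex : ∃ u, n ≤ u ∨ c ≤ G u := ⟨n, Or.inl le_rfl⟩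
  refine ⟨Nat.find hex, Nat.find_min' hex (Or.inl le_rfl), fun s hs => ⟨fun h => ?_, fun h => ?_⟩⟩
  · have := Nat.find_min hex h
    omega
  · by_contra hc
    have := hG _ s (not_lt.1 hc) hs
    have := Nat.find_spec hex
    omega

section CyclicOrder

variable {n : ℕ} [NeZero n] {P : Finset (Prp n)} (hadm : IsAdmissible n P) {i j : ZMod n}
include hadm

lemma IsAdmissible.exists_gnAssign_eq_and_sub_one_ne (hp : s(i, j) ∈ P) :
    ∃ a, gnAssign n P a s(i, j) = some i ∧ gnAssign n P (a - 1) s(i, j) ≠ some i := by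
  have hd := hadm.two_le_ord hp
  have hij : i ≠ j := by
    rintro rfl
    simp [ord] at hd
  have hi : gnAssign n P (j + 2) s(i, j) = some i := by
    rw [Sym2.eq_swap]
    exact hadm.gnAssign_add_two (Sym2.eq_swap ▸ hp)
  by_contra! hc
  have hall (t : ℕ) : gnAssign n P (j + 2 - (t : ZMod n)) s(i, j) = some i := by
    induction t with
    | zero => simpa using hi
    | succ t ih =>
      rw [Nat.cast_succ, ← sub_sub]
      exact hc _ ih
  have h := hall (ord n i j)
  rw [show j + 2 - (ord n i j : ZMod n) = i + 2 by
    nth_rewrite 1 [← add_ord i j]; ring, hadm.gnAssign_add_two hp, Option.some_inj] at h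
  exact hij h.symm

/-- The vertex contributed by a propagator moves forward monotonically as the starting vertex does,
once the starting vertices are read from the first one contributing the end `i`. -/
lemma IsAdmissible.exists_monotone_assign (hp : s(i, j) ∈ P) :
    ∃ (a : ZMod n) (h : ZMod n → ZMod n), (∀ m, gnAssign n P m s(i, j) = some (h m)) ∧
      (∀ m, h m ∈ supp n s(i, j)) ∧
      ∀ s t : ℕ, s ≤ t → t < n → ord n i (h (a + (s : ZMod n))) ≤ ord n i (h (a + (t : ZMod n))) := by
  choose τ hτn hτ using fun m => hadm.exists_pick (m := m) hp
  have hassign (m : ZMod n) : gnAssign n P m s(i, j) = some (m + (τ m : ZMod n)) :=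
    gnRun_snd_eq_some_iff.2 ⟨τ m, hτn m, hτ m, rfl⟩
  have hτ_le (m : ZMod n) : τ m ≤ τ (m + 1) + 1 := by
    by_contra! hc
    have hmem : s(i, j) ∈ (gnRun n P m (τ (m + 1) + 1 + 1)).1 :=
      gnRun_antitone (by omega) (pickCW_eq_some_iff.1 (hτ m)).1
    exact notMem_gnRun_of_pick (Nat.lt_succ_self _) (hτ (m + 1))
      (gnRun_succ_subset_gnRun_add_one _ hmem)
  obtain ⟨a, ha, ha'⟩ := hadm.exists_gnAssign_eq_and_sub_one_ne hp
  rw [hassign, Option.some_inj] at ha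
  rw [hassign, Ne, Option.some_inj] at ha'
  refine ⟨a, fun m => m + (τ m : ZMod n), hassign,
    fun m => (pickCW_eq_some_iff.1 (hτ m)).2.1, ?_⟩
  set F : ℕ → ℕ := fun s => s + τ (a + (s : ZMod n)) with hF
  have hmono : Monotone F := monotone_nat_of_le_succ fun s => by
    have := hτ_le (a + (s : ZMod n))
    simp only [hF, Nat.cast_succ, ← add_assoc]
    omega
  have hFa (s : ℕ) : a + (s : ZMod n) + (τ (a + (s : ZMod n)) : ZMod n) = a + (F s : ZMod n) := by
    simp only [hF]
    push_cast
    ring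
  have hF0 : a + (F 0 : ZMod n) = i := by simpa [hF] using ha
  have hFn : F n = F 0 + n := by simp [hF, add_comm]
  have hn : 0 < n := Nat.pos_of_ne_zero (NeZero.ne n)
  have hlast : F (n - 1) < F 0 + n := by
    refine lt_of_le_of_ne (hFn ▸ hmono (by omega)) fun hc => ha' ?_
    have h1 : a + ((n - 1 : ℕ) : ZMod n) = a - 1 := by
      rw [Nat.cast_sub hn, ZMod.natCast_self]
      ring
    rw [← h1, hFa, hc, Nat.cast_add, ZMod.natCast_self, add_zero, hF0]
  have hord (s : ℕ) (hs : s < n) :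
      ord n i (a + (s : ZMod n) + (τ (a + (s : ZMod n)) : ZMod n)) = F s - F 0 := by
    have h1 := hmono (Nat.zero_le s)
    have h2 := hmono (show s ≤ n - 1 by omega)
    rw [hFa, ← hF0]
    exact ord_add_add_of_le a h1 (by omega)
  intro s t hst ht
  rw [hord s (by omega), hord t ht]
  exact Nat.sub_le_sub_right (hmono hst) _

end CyclicOrder

/-- the sets `J_p^W(v)` are nonempty cyclic intervals in cyclic
order.  Let `W = (P,[n])` be an admissible Wilson loop diagram.  For every
propagator `p = (i,j) ∈ P`, the four sets `J_p^W(v) = {m : I_m^W(p) = v}` for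
`v ∈ {i, i+1, j, j+1}` are nonempty cyclic intervals partitioning `[n]` and
occurring around the cycle in the order `J_p^W(i), J_p^W(i+1), J_p^W(j),
J_p^W(j+1)`. -/
theorem gnAssign_fibers_cyclic_intervals
    (n : ℕ) [NeZero n] (P : Finset (Prp n)) (hadm : IsAdmissible n P) :
    ∀ p ∈ P, ∀ i j : ZMod n, p = s(i, j) →
      ∃ (a : ZMod n) (l₁ l₂ l₃ l₄ : ℕ),
        0 < l₁ ∧ 0 < l₂ ∧ 0 < l₃ ∧ 0 < l₄ ∧ l₁ + l₂ + l₃ + l₄ = n ∧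
        (Finset.univ.filter fun m => gnAssign n P m p = some i) = cInterval n a l₁ ∧
        (Finset.univ.filter fun m => gnAssign n P m p = some (i + 1)) =
          cInterval n (a + (l₁ : ZMod n)) l₂ ∧
        (Finset.univ.filter fun m => gnAssign n P m p = some j) =
          cInterval n (a + ((l₁ + l₂ : ℕ) : ZMod n)) l₃ ∧
        (Finset.univ.filter fun m => gnAssign n P m p = some (j + 1)) =
          cInterval n (a + ((l₁ + l₂ + l₃ : ℕ) : ZMod n)) l₄ := by
  rintro p hp i j rfl
  have hd := hadm.two_le_ord hp
  have hp' : s(j, i) ∈ P := Sym2.eq_swap ▸ hp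
  obtain ⟨a, h, hassign, hsupp, hmono⟩ := hadm.exists_monotone_assign hp
  have o0 : ord n i i = 0 := by simp [ord]
  have o1 : ord n i (i + 1) = 1 := by
    simpa using ord_add_natCast i (x := 1) (by omega)
  have oj : ord n i (j + 1) = ord n i j + 1 := by
    have := ord_add_natCast i (x := ord n i j + 1) (by omega)
    rwa [Nat.cast_succ, ← add_assoc, add_ord] at this
  have hvals (m : ZMod n) : ord n i (h m) = 0 ∨ ord n i (h m) = 1 ∨ ord n i (h m) = ord n i j ∨
      ord n i (h m) = ord n i j + 1 := by
    rcases mem_supp_mk.1 (hsupp m) with h1 | h1 | h1 | h1 <;> rw [h1] <;> simp [o0, o1, oj]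
  have hattain {v : ZMod n} (hv : ∃ m, gnAssign n P m s(i, j) = some v) :
      ∃ s < n, ord n i (h (a + (s : ZMod n))) = ord n i v := by
    obtain ⟨m, hm⟩ := hv
    rw [hassign, Option.some_inj] at hm
    exact ⟨ord n a m, ord_lt a m, by rw [add_ord, hm]⟩
  obtain ⟨s₁, hs₁, e₁⟩ := hattain (v := i)
    ⟨j + 2, by rw [Sym2.eq_swap]; exact hadm.gnAssign_add_two hp'⟩
  obtain ⟨s₂, hs₂, e₂⟩ := hattain (hadm.exists_gnAssign_add_one hp)
  obtain ⟨s₃, hs₃, e₃⟩ := hattain ⟨_, hadm.gnAssign_add_two hp⟩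
  obtain ⟨s₄, hs₄, e₄⟩ := hattain (v := j + 1)
    (by rw [Sym2.eq_swap]; exact hadm.exists_gnAssign_add_one hp')
  obtain ⟨u₁, hu₁, k₁⟩ := exists_threshold hmono 1
  obtain ⟨u₂, hu₂, k₂⟩ := exists_threshold hmono (ord n i j)
  obtain ⟨u₃, hu₃, k₃⟩ := exists_threshold hmono (ord n i j + 1)
  have a₁ := k₁ s₁ hs₁
  have a₂ := k₁ s₂ hs₂
  have a₃ := k₂ s₂ hs₂
  have a₄ := k₂ s₃ hs₃
  have a₅ := k₃ s₃ hs₃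
  have a₆ := k₃ s₄ hs₄
  rw [o0] at e₁
  rw [o1] at e₂
  rw [oj] at e₄
  have hfiber {v : ZMod n} {t l : ℕ} (htl : t + l ≤ n)
      (hv : ∀ s < n, ord n i (h (a + (s : ZMod n))) = ord n i v ↔ t ≤ s ∧ s < t + l) :
      (Finset.univ.filter fun m => gnAssign n P m s(i, j) = some v) =
        cInterval n (a + (t : ZMod n)) l := by
    ext m
    rw [mem_cInterval_add htl, ← hv _ (ord_lt a m), add_ord]
    simp only [Finset.mem_filter, Finset.mem_univ, true_and, hassign, Option.some_inj]
    exact ⟨fun e => by rw [e], ord_inj⟩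
  have hcase (s : ℕ) (hs : s < n) := And.intro (hvals (a + (s : ZMod n)))
    (And.intro (k₁ s hs) (And.intro (k₂ s hs) (k₃ s hs)))
  refine ⟨a, u₁, u₂ - u₁, u₃ - u₂, n - u₃, by omega, by omega, by omega, by omega, by omega,
    ?_, hfiber (by omega) fun s hs => ?_, hfiber (by omega) fun s hs => ?_,
    hfiber (by omega) fun s hs => ?_⟩
  · have := hfiber (v := i) (t := 0) (l := u₁) (by omega) fun s hs => by
      have := hcase s hs
      omega
    simpa using this
  all_goals
    have := hcase s hs
    omega

end WLD
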